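/- arXiv:1712.06559 — 4 statements merged into one kernel-verified Lean document; each statement's English description precedes it below -/
import Mathlib

section
/- Let m ≥ 1, p ∈ [0,1], and let η > 0 satisfy η·β ≤ p·m and (m−1)·η·λ ≤ (1−p)·m. Then for every w ∈ H, L(w) − (η/2)·E‖(1/m)∑_{j=1}^m ∇ℓ_{i_j}(w)‖² ≥ 0, where E[·] is the average over all m-tuples (i₁,…,i_m) ∈ {1,…,n}^m. -/
open RealInnerProductSpace Finset

section SampleSums

variable {ι E : Type*} [Fintype ι]

/-- A sum over tuples of length `m + 1` splits into the first entry and the remaining tuple. -/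
theorem sum_tuple_succ {M : Type*} [AddCommMonoid M] (m : ℕ) (F : (Fin (m + 1) → ι) → M) :
    ∑ s, F s = ∑ i, ∑ s : Fin m → ι, F (Fin.cons i s) := by
  rw [← (Fin.consEquiv fun _ : Fin (m + 1) => ι).sum_comp, Fintype.sum_prod_type]
  rfl

/-- First moment of the sum of `m` independent uniform samples from a finite family. -/
theorem card_smul_sum_tuple_sum [AddCommGroup E] [Module ℝ E] (x : ι → E) (m : ℕ) :
    (Fintype.card ι : ℝ) • ∑ s : Fin m → ι, ∑ j, x (s j) =
      ((m : ℝ) * (Fintype.card ι : ℝ) ^ m) • ∑ i, x i := by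
  induction m with
  | zero => simp
  | succ m ih =>
    rw [sum_tuple_succ]
    simp only [Fin.sum_univ_succ, Fin.cons_zero, Fin.cons_succ, sum_add_distrib, sum_const,
      card_univ, Fintype.card_fun, Fintype.card_fin, ← Nat.cast_smul_eq_nsmul ℝ, ← smul_sum]
    rw [ih]
    push_cast
    module

/-- Second moment of the sum of `m` independent uniform samples from a finite family. -/
theorem card_sq_mul_sum_tuple_norm_sq [NormedAddCommGroup E] [InnerProductSpace ℝ E]
    (x : ι → E) (m : ℕ) :
    (Fintype.card ι : ℝ) ^ 2 * ∑ s : Fin m → ι, ‖∑ j, x (s j)‖ ^ 2 =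
      (Fintype.card ι : ℝ) ^ m * (m * Fintype.card ι * ∑ i, ‖x i‖ ^ 2 +
        m * (m - 1) * ‖∑ i, x i‖ ^ 2) := by
  induction m with
  | zero => simp
  | succ m ih =>
    have hcross : (Fintype.card ι : ℝ) * ⟪∑ i, x i, ∑ s : Fin m → ι, ∑ j, x (s j)⟫ =
        m * (Fintype.card ι : ℝ) ^ m * ‖∑ i, x i‖ ^ 2 := by
      rw [← real_inner_smul_right, card_smul_sum_tuple_sum, real_inner_smul_right,
        real_inner_self_eq_norm_sq]
    rw [sum_tuple_succ]
    simp only [Fin.sum_univ_succ, Fin.cons_zero, Fin.cons_succ, norm_add_sq_real,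
      sum_add_distrib, sum_const, card_univ, Fintype.card_fun, Fintype.card_fin, nsmul_eq_mul,
      ← mul_sum, ← inner_sum, ← sum_inner]
    push_cast
    linear_combination (Fintype.card ι : ℝ) * ih + 2 * (Fintype.card ι : ℝ) * hcross

end SampleSums

/-- Self-bounding property of nonnegative smooth functions. -/
theorem norm_sq_le_of_nonneg_of_smooth {E : Type*} [NormedAddCommGroup E] [InnerProductSpace ℝ E]
    {f : E → ℝ} {w d : E} {B : ℝ} (hB : 0 ≤ B) (hf : ∀ v, 0 ≤ f v)
    (hsmooth : ∀ v, f v ≤ f w + ⟪d, v - w⟫ + B / 2 * ‖v - w‖ ^ 2) :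
    ‖d‖ ^ 2 ≤ 2 * B * f w := by
  have hquad (t : ℝ) : 0 ≤ B / 2 * ‖d‖ ^ 2 * (t * t) + -‖d‖ ^ 2 * t + f w := by
    have h := (hf _).trans (hsmooth (w - t • d))
    rw [sub_sub_cancel_left, norm_neg, norm_smul, inner_neg_right, real_inner_smul_right,
      real_inner_self_eq_norm_sq, mul_pow, Real.norm_eq_abs, sq_abs] at h
    linarith
  have hdisc := discrim_le_zero hquad
  rw [discrim] at hdisc
  rcases (sq_nonneg ‖d‖).eq_or_lt with h | h
  · rw [← h]
    exact mul_nonneg (mul_nonneg zero_le_two hB) (hf w)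
  · exact le_of_mul_le_mul_right (by linarith) h

/-- The gradient of a finite average is the average of the gradients. -/
theorem hasGradientAt_const_mul_sum {ι E : Type*} [Fintype ι] [NormedAddCommGroup E]
    [InnerProductSpace ℝ E] [CompleteSpace E] {f : ι → E → ℝ} {d : ι → E} {w : E} (c : ℝ)
    (h : ∀ i, HasGradientAt (f i) (d i) w) :
    HasGradientAt (fun v => c * ∑ i, f i v) (c • ∑ i, d i) w := by
  rw [hasGradientAt_iff_hasFDerivAt, map_smul, map_sum]
  exact (HasFDerivAt.fun_sum fun i _ => (h i).hasFDerivAt).const_mul c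

/-- If `η·β ≤ p·m` and `(m−1)·η·λ ≤ (1−p)·m` for some `p ∈ [0,1]`, then
`L(w) − (η/2)·E‖mini-batch gradient‖² ≥ 0`. -/
theorem minibatch_stepsize_condition
    {H : Type*} [NormedAddCommGroup H] [InnerProductSpace ℝ H] [CompleteSpace H]
    (n : ℕ) (hn : 1 ≤ n)
    (ℓ : Fin n → H → ℝ) (g : Fin n → H → H)
    (β lam : ℝ)
    (hgrad : ∀ i w, HasGradientAt (ℓ i) (g i w) w)
    (hnonneg : ∀ i w, 0 ≤ ℓ i w)
    (hconvex : ∀ i w v, ℓ i w + ⟪g i w, v - w⟫ ≤ ℓ i v)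
    (hsmooth : ∀ i w v, ℓ i v ≤ ℓ i w + ⟪g i w, v - w⟫ + β / 2 * ‖v - w‖ ^ 2)
    (L : H → ℝ) (hL : ∀ w, L w = (1 / (n : ℝ)) * ∑ i, ℓ i w)
    (gL : H → H) (hgL : ∀ w, HasGradientAt L (gL w) w)
    (hLsmooth : ∀ w v, L v ≤ L w + ⟪gL w, v - w⟫ + lam / 2 * ‖v - w‖ ^ 2)
    (m : ℕ) (hm : 1 ≤ m)
    (p : ℝ) (hp0 : 0 ≤ p) (hp1 : p ≤ 1)
    (η : ℝ) (hη : 0 < η)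
    (hηβ : η * β ≤ p * (m : ℝ))
    (hηlam : ((m : ℝ) - 1) * η * lam ≤ (1 - p) * (m : ℝ)) :
    ∀ w : H,
      0 ≤ L w - (η / 2) *
            ((1 / (n : ℝ) ^ m) *
              ∑ s : Fin m → Fin n, ‖(1 / (m : ℝ)) • ∑ j, g (s j) w‖ ^ 2) := by
  intro w
  have hn0 : (0 : ℝ) < n := by exact_mod_cast hn
  have hm0 : (0 : ℝ) < m := by exact_mod_cast hm
  have hm1 : (0 : ℝ) ≤ m - 1 := sub_nonneg.2 (by exact_mod_cast hm)
  have hL0 (v : H) : 0 ≤ L v := by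
    rw [hL]
    exact mul_nonneg (by positivity) (sum_nonneg fun i _ => hnonneg i v)
  have hgLw : gL w = (1 / (n : ℝ)) • ∑ i, g i w := by
    refine (hgL w).unique ?_
    rw [funext hL]
    exact hasGradientAt_const_mul_sum _ fun i => hgrad i w
  have hsum : ∑ i, ‖g i w‖ ^ 2 ≤ 2 * (p * m / η) * (n * L w) := by
    have hLn : n * L w = ∑ i, ℓ i w := by
      rw [hL]
      field_simp
    rw [hLn, mul_sum]
    refine sum_le_sum fun i _ => norm_sq_le_of_nonneg_of_smooth (by positivity) (hnonneg i)
      fun v => (hsmooth i w v).trans ?_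
    gcongr
    rw [le_div_iff₀ hη]
    linarith
  have hmean : (m - 1) * η * ‖gL w‖ ^ 2 ≤ 2 * ((1 - p) * m) * L w := by
    rcases hm1.eq_or_lt with h | h
    · rw [← h, zero_mul, zero_mul]
      exact mul_nonneg (mul_nonneg zero_le_two (mul_nonneg (sub_nonneg.2 hp1) hm0.le)) (hL0 w)
    · have hpos : 0 < (m - 1) * η := mul_pos h hη
      have hbound : ‖gL w‖ ^ 2 ≤ 2 * ((1 - p) * m / ((m - 1) * η)) * L w := by
        refine norm_sq_le_of_nonneg_of_smooth
          (div_nonneg (mul_nonneg (sub_nonneg.2 hp1) hm0.le) hpos.le) hL0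
          fun v => (hLsmooth w v).trans ?_
        gcongr
        rw [le_div_iff₀ hpos]
        linarith
      calc (m - 1) * η * ‖gL w‖ ^ 2
          ≤ (m - 1) * η * (2 * ((1 - p) * m / ((m - 1) * η)) * L w) := by gcongr
        _ = 2 * ((1 - p) * m) * L w := by
          field_simp
  have hmoment : (1 / (n : ℝ) ^ m) *
      ∑ s : Fin m → Fin n, ‖(1 / (m : ℝ)) • ∑ j, g (s j) w‖ ^ 2 =
        1 / (m * n) * ∑ i, ‖g i w‖ ^ 2 + (m - 1) / m * ‖gL w‖ ^ 2 := by
    have h := card_sq_mul_sum_tuple_norm_sq (fun i => g i w) m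
    rw [Fintype.card_fin, mul_comm, ← eq_div_iff (by positivity)] at h
    simp only [hgLw, norm_smul, mul_pow, ← mul_sum, h, Real.norm_eq_abs, sq_abs]
    field_simp
  rw [hmoment, sub_nonneg]
  calc η / 2 * (1 / (m * n) * ∑ i, ‖g i w‖ ^ 2 + (m - 1) / m * ‖gL w‖ ^ 2)
      = η / (2 * m * n) * ∑ i, ‖g i w‖ ^ 2 + 1 / (2 * m) * ((m - 1) * η * ‖gL w‖ ^ 2) := by
        field_simp
    _ ≤ η / (2 * m * n) * (2 * (p * m / η) * (n * L w)) +
          1 / (2 * m) * (2 * ((1 - p) * m) * L w) := by gcongr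
    _ = L w := by
        field_simp
        ring
end

section
/- In the quadratic interpolation setting, for every batch size m ≥ 1, every η ≥ 0, and every w ∈ ℝ^d with δ = w − w*: E‖P(δ − η·H_m·δ)‖² ≤ g(m, η)·‖Pδ‖², where H_m = (1/m)∑_{j=1}^m x_{i_j}x_{i_j}ᵀ and E[·] is the average over all m-tuples (i₁,…,i_m) ∈ {1,…,n}^m. -/
open RealInnerProductSpace Finset

/-- The rank-one operator `u ↦ ⟪v, u⟫ v`. -/
noncomputable def rankOne {d : ℕ} (v : EuclideanSpace ℝ (Fin d)) :
    EuclideanSpace ℝ (Fin d) →ₗ[ℝ] EuclideanSpace ℝ (Fin d) where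
  toFun u := ⟪v, u⟫ • v
  map_add' a b := by simp [inner_add_right, add_smul]
  map_smul' c a := by simp [inner_smul_right, mul_smul]

/-- The sample covariance operator `H = (1/n) ∑ᵢ xᵢxᵢᵀ` as a linear map. -/
noncomputable def covOp {n d : ℕ} (x : Fin n → EuclideanSpace ℝ (Fin d)) :
    EuclideanSpace ℝ (Fin d) →ₗ[ℝ] EuclideanSpace ℝ (Fin d) :=
  (1 / (n : ℝ)) • ∑ i, rankOne (x i)

/-- Second moment of a shifted sum of `m` independent uniform draws from a finite family,
by the bias-variance decomposition. -/
lemma sum_norm_sq_add_sum_draws {E : Type*} [NormedAddCommGroup E] [InnerProductSpace ℝ E]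
    {n : ℕ} (g : Fin n → E) (h : E) (A : ℝ) (hh : ∑ i, g i = (n : ℝ) • h)
    (hA : ∑ i, ‖g i‖ ^ 2 = n * A) (m : ℕ) (u : E) :
    ∑ s : Fin m → Fin n, ‖u + ∑ j, g (s j)‖ ^ 2 =
      (n : ℝ) ^ m * (‖u + (m : ℝ) • h‖ ^ 2 + m * (A - ‖h‖ ^ 2)) := by
  induction m generalizing u with
  | zero => simp
  | succ m ih =>
    have hsplit : ∑ s : Fin (m + 1) → Fin n, ‖u + ∑ j, g (s j)‖ ^ 2 =
        ∑ i, ∑ s : Fin m → Fin n, ‖(u + g i) + ∑ j, g (s j)‖ ^ 2 := by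
      rw [← Fintype.sum_prod_type',
        ← (Fin.consEquiv (fun _ : Fin (m + 1) => Fin n)).sum_comp]
      refine Finset.sum_congr rfl fun p _ => ?_
      simp [Fin.consEquiv, Fin.sum_univ_succ, add_assoc]
    have hdraw : ∀ a : E, ∑ i, ‖a + g i‖ ^ 2 = n * (‖a + h‖ ^ 2 + (A - ‖h‖ ^ 2)) := by
      intro a
      simp_rw [norm_add_sq_real, Finset.sum_add_distrib, ← Finset.mul_sum, ← inner_sum, hh, hA,
        inner_smul_right]
      simp
      ring
    have hcomm : ∀ i, u + g i + (m : ℝ) • h = (u + (m : ℝ) • h) + g i := fun i => by abel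
    have hend : u + ((m + 1 : ℕ) : ℝ) • h = (u + (m : ℝ) • h) + h := by
      push_cast
      rw [add_smul, one_smul, add_assoc]
    rw [hsplit, hend]
    simp_rw [ih, hcomm, ← Finset.mul_sum, Finset.sum_add_distrib, hdraw]
    simp
    ring

lemma covOp_apply {n d : ℕ} (x : Fin n → EuclideanSpace ℝ (Fin d))
    (u : EuclideanSpace ℝ (Fin d)) :
    covOp x u = (1 / (n : ℝ)) • ∑ i, ⟪x i, u⟫ • x i := by
  simp [covOp, rankOne, LinearMap.sum_apply]

lemma inner_covOp {n d : ℕ} (x : Fin n → EuclideanSpace ℝ (Fin d))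
    (u v : EuclideanSpace ℝ (Fin d)) :
    ⟪u, covOp x v⟫ = (1 / (n : ℝ)) * ∑ i, ⟪x i, u⟫ * ⟪x i, v⟫ := by
  rw [covOp_apply, inner_smul_right, inner_sum]
  congr 1
  refine Finset.sum_congr rfl fun i _ => ?_
  rw [inner_smul_right, real_inner_comm u, mul_comm]

lemma covOp_isSymmetric {n d : ℕ} (x : Fin n → EuclideanSpace ℝ (Fin d)) :
    (covOp x).IsSymmetric := by
  intro u v
  rw [real_inner_comm, inner_covOp, inner_covOp]
  simp_rw [mul_comm]

lemma mem_range_covOp {n d : ℕ} (x : Fin n → EuclideanSpace ℝ (Fin d)) (i : Fin n) :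
    x i ∈ LinearMap.range (covOp x) := by
  rw [← Submodule.orthogonal_orthogonal (LinearMap.range (covOp x)),
    (covOp_isSymmetric x).orthogonal_range]
  intro u hu
  have hn : (0 : ℝ) < n := by exact_mod_cast i.pos
  have hzero : ∑ j, ⟪x j, u⟫ * ⟪x j, u⟫ = 0 := by
    have h := inner_covOp x u u
    rw [LinearMap.mem_ker.mp hu, inner_zero_right] at h
    exact (mul_eq_zero.mp h.symm).resolve_left (by positivity)
  rw [Finset.sum_eq_zero_iff_of_nonneg fun j _ => mul_self_nonneg _] at hzero
  rw [real_inner_comm]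
  exact mul_self_eq_zero.mp (hzero i (Finset.mem_univ i))

lemma sum_norm_sq_gradient_le {n d : ℕ} (hn : 1 ≤ n) (x : Fin n → EuclideanSpace ℝ (Fin d))
    {β : ℝ} (hβ : ∀ i, ‖x i‖ ^ 2 ≤ β) (v : EuclideanSpace ℝ (Fin d)) :
    (1 / (n : ℝ)) * ∑ i, ‖⟪x i, v⟫ • x i‖ ^ 2 ≤ β * ⟪v, covOp x v⟫ := by
  rw [inner_covOp, mul_left_comm, Finset.mul_sum _ _ β]
  gcongr with i
  rw [norm_smul, mul_pow, Real.norm_eq_abs, sq_abs]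
  nlinarith [mul_le_mul_of_nonneg_left (hβ i) (sq_nonneg ⟪x i, v⟫)]

/-- The mini-batch step bound in terms of the covariance operator. -/
lemma average_norm_sq_sub_batch_le {n d : ℕ} (hn : 1 ≤ n)
    (x : Fin n → EuclideanSpace ℝ (Fin d)) {β : ℝ} (hβ : ∀ i, ‖x i‖ ^ 2 ≤ β)
    {m : ℕ} (hm : 1 ≤ m) (η : ℝ) (v : EuclideanSpace ℝ (Fin d)) :
    (1 / (n : ℝ) ^ m) * ∑ s : Fin m → Fin n,
        ‖v - η • ((1 / (m : ℝ)) • ∑ j, ⟪x (s j), v⟫ • x (s j))‖ ^ 2 ≤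
      ‖v - η • covOp x v‖ ^ 2 +
        η ^ 2 / m * (β * ⟪v, covOp x v⟫ - ‖covOp x v‖ ^ 2) := by
  have hn' : (n : ℝ) ≠ 0 := by positivity
  have hm' : (m : ℝ) ≠ 0 := by positivity
  set c : ℝ := -(η / m) with hc
  set A : ℝ := (1 / (n : ℝ)) * ∑ i, ‖⟪x i, v⟫ • x i‖ ^ 2 with hAdef
  have hstep : ∀ s : Fin m → Fin n,
      v - η • ((1 / (m : ℝ)) • ∑ j, ⟪x (s j), v⟫ • x (s j)) =
        v + ∑ j, c • (⟪x (s j), v⟫ • x (s j)) := by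
    intro s
    rw [← Finset.smul_sum, smul_smul, hc, neg_smul, sub_eq_add_neg, mul_one_div]
  have hsum := sum_norm_sq_add_sum_draws (fun i => c • (⟪x i, v⟫ • x i)) (c • covOp x v)
    (c ^ 2 * A)
    (by
      rw [← Finset.smul_sum, covOp_apply, smul_comm, smul_smul (n : ℝ), mul_one_div_cancel hn',
        one_smul])
    (by
      simp_rw [norm_smul c, mul_pow, Real.norm_eq_abs, sq_abs]
      rw [← Finset.mul_sum, hAdef]
      simp_rw [norm_smul, mul_pow, Real.norm_eq_abs, sq_abs]
      field_simp) m v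
  have hmean : v + (m : ℝ) • c • covOp x v = v - η • covOp x v := by
    rw [smul_smul, hc, mul_neg, mul_div_cancel₀ _ hm', neg_smul, sub_eq_add_neg]
  simp_rw [hstep]
  rw [hsum, hmean, ← mul_assoc, one_div_mul_cancel (pow_ne_zero _ hn'), one_mul, norm_smul,
    mul_pow, Real.norm_eq_abs, sq_abs]
  have hcoef : (m : ℝ) * (c ^ 2 * A - c ^ 2 * ‖covOp x v‖ ^ 2) =
      η ^ 2 / m * (A - ‖covOp x v‖ ^ 2) := by
    rw [hc]
    field_simp
  rw [hcoef]
  gcongr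
  exact sum_norm_sq_gradient_le hn x hβ v

/-- Spectral form of the mini-batch step bound. -/
lemma step_bound_eq_sum_eigen {d : ℕ} (T : EuclideanSpace ℝ (Fin d) →ₗ[ℝ] EuclideanSpace ℝ (Fin d))
    (hT : T.IsSymmetric) (e : OrthonormalBasis (Fin d) ℝ (EuclideanSpace ℝ (Fin d)))
    (lam : Fin d → ℝ) (heig : ∀ i, T (e i) = lam i • e i) (η β m : ℝ)
    (v : EuclideanSpace ℝ (Fin d)) :
    ‖v - η • T v‖ ^ 2 + η ^ 2 / m * (β * ⟪v, T v⟫ - ‖T v‖ ^ 2) =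
      ∑ i, ((1 - η * lam i) ^ 2 + η ^ 2 * lam i / m * (β - lam i)) * ⟪e i, v⟫ ^ 2 := by
  have hcoord : ∀ i, ⟪e i, T v⟫ = lam i * ⟪e i, v⟫ := fun i => by
    rw [← hT, heig, real_inner_smul_left]
  have hinner : ⟪v, T v⟫ = ∑ i, lam i * ⟪e i, v⟫ ^ 2 := by
    rw [← e.sum_inner_mul_inner]
    refine Finset.sum_congr rfl fun i _ => ?_
    rw [hcoord, real_inner_comm]
    ring
  have hnorm : ∀ u, ‖u‖ ^ 2 = ∑ i, ⟪e i, u⟫ ^ 2 := fun u => by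
    simp [← e.sum_sq_norm_inner_right u]
  rw [hinner, hnorm, hnorm (T v), Finset.mul_sum, ← Finset.sum_sub_distrib, Finset.mul_sum,
    ← Finset.sum_add_distrib]
  refine Finset.sum_congr rfl fun i _ => ?_
  rw [inner_sub_right, inner_smul_right, hcoord]
  ring

/-- In the quadratic interpolation setting, a single mini-batch SGD step contracts the
expected squared norm of the projected error by the factor
`g(m,η) = max_{λ ∈ [λ_k, λ₁]} (1 − ηλ)² + (η²λ/m)(β − λ)`. -/
theorem quadratic_sgd_one_step_contraction
    (d n : ℕ) (hn : 1 ≤ n)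
    (x : Fin n → EuclideanSpace ℝ (Fin d)) (y : Fin n → ℝ)
    (β : ℝ) (hβ : ∀ i, ‖x i‖ ^ 2 ≤ β)
    (wstar : EuclideanSpace ℝ (Fin d)) (hinterp : ∀ i, ⟪wstar, x i⟫ = y i)
    -- eigendecomposition of H = covOp x, with eigenvalues λ₁ ≥ ⋯ ≥ λ_k > 0 = ⋯ = λ_d
    (k : ℕ) (hk1 : 1 ≤ k) (hkd : k ≤ d)
    (e : OrthonormalBasis (Fin d) ℝ (EuclideanSpace ℝ (Fin d)))
    (lam : Fin d → ℝ)
    (heig : ∀ i, covOp x (e i) = lam i • e i)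
    (hmono : ∀ i j : Fin d, i ≤ j → lam j ≤ lam i)
    (hpos : ∀ i : Fin d, (i : ℕ) < k → 0 < lam i)
    (hzero : ∀ i : Fin d, k ≤ (i : ℕ) → lam i = 0)
    (lam1 lamk : ℝ)
    (hlam1 : lam1 = lam ⟨0, by omega⟩)
    (hlamk : lamk = lam ⟨k - 1, by omega⟩)
    -- P is the orthogonal projection onto Range(H)
    (P : EuclideanSpace ℝ (Fin d) → EuclideanSpace ℝ (Fin d))
    (hPmem : ∀ u, P u ∈ LinearMap.range (covOp x))
    (hPorth : ∀ u, u - P u ∈ (LinearMap.range (covOp x))ᗮ)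
    (m : ℕ) (hm : 1 ≤ m)
    (η : ℝ) (hη : 0 ≤ η) :
    ∀ w : EuclideanSpace ℝ (Fin d),
      (1 / (n : ℝ) ^ m) *
          ∑ s : Fin m → Fin n,
            ‖P ((w - wstar)
              - η • ((1 / (m : ℝ)) • ∑ j, ⟪x (s j), w - wstar⟫ • x (s j)))‖ ^ 2
        ≤ (sSup ((fun l => (1 - η * l) ^ 2 + η ^ 2 * l / (m : ℝ) * (β - l)) ''
              Set.Icc lamk lam1)) * ‖P (w - wstar)‖ ^ 2 := by
  intro w
  set V := LinearMap.range (covOp x) with hV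
  set δ := w - wstar
  have hP : ∀ u, P u = V.starProjection u := fun u =>
    (Submodule.eq_starProjection_of_mem_of_inner_eq_zero (hPmem u) fun z hz =>
      Submodule.inner_left_of_mem_orthogonal hz (hPorth u)).symm
  have hPx : ∀ i, V.starProjection (x i) = x i := fun i =>
    Submodule.starProjection_eq_self_iff.mpr (mem_range_covOp x i)
  have hinner : ∀ i, ⟪x i, δ⟫ = ⟪x i, P δ⟫ := fun i => by
    rw [hP, ← Submodule.inner_starProjection_left_eq_right, hPx]
  have hproj : ∀ s : Fin m → Fin n,
      P (δ - η • ((1 / (m : ℝ)) • ∑ j, ⟪x (s j), δ⟫ • x (s j))) =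
        P δ - η • ((1 / (m : ℝ)) • ∑ j, ⟪x (s j), P δ⟫ • x (s j)) := by
    intro s
    rw [hP]
    simp only [map_sub, map_smul, map_sum, hPx, hinner]
    rw [hP]
  simp_rw [hproj]
  refine (average_norm_sq_sub_batch_le hn x hβ hm η (P δ)).trans ?_
  rw [step_bound_eq_sum_eigen _ (covOp_isSymmetric x) e lam heig]
  have hnorm : ‖P δ‖ ^ 2 = ∑ i, ⟪e i, P δ⟫ ^ 2 := by
    simp [← e.sum_sq_norm_inner_right (P δ)]
  rw [hnorm, Finset.mul_sum]
  refine Finset.sum_le_sum fun i _ => ?_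
  by_cases hik : (i : ℕ) < k
  · gcongr
    refine le_csSup (isCompact_Icc.image (by fun_prop)).bddAbove
      (Set.mem_image_of_mem (fun l => (1 - η * l) ^ 2 + η ^ 2 * l / (m : ℝ) * (β - l)) ⟨?_, ?_⟩)
    · rw [hlamk]
      exact hmono _ _ (Fin.le_def.mpr (by simp; omega))
    · rw [hlam1]
      exact hmono _ _ (Fin.le_def.mpr (by simp))
  · obtain ⟨u, hu⟩ := hPmem δ
    have hvanish : ⟪e i, P δ⟫ = 0 := by
      rw [← hu, ← covOp_isSymmetric x, heig, hzero i (by omega), zero_smul, inner_zero_left]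
    simp [hvanish]
end

section
/- In the rate-function setting, with ηᴵ(m) = min(η₀(m), m/(β + (m−1)λ_k)), one has gᴵ(m, ηᴵ(m)) ≤ gᴵᴵ(m, η₀(m)) = 1 − 4m(m−1)λ₁λ_k/(β + (m−1)(λ₁ + λ_k))² for every m ≥ 1. -/
/-- The rate function `g(λ; m, η) = (1 − ηλ)² + (η²λ/m)(β − λ)`. -/
noncomputable def gq (β : ℝ) (m : ℕ) (l η : ℝ) : ℝ :=
  (1 - η * l) ^ 2 + η ^ 2 * l / (m : ℝ) * (β - l)

/-- `η₀(m) = 2m/(β + (m−1)(λ₁ + λ_k))`. -/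
noncomputable def eta0 (β lam1 lamk : ℝ) (m : ℕ) : ℝ :=
  2 * (m : ℝ) / (β + ((m : ℝ) - 1) * (lam1 + lamk))

/-- Completing the square in the step size around the minimizer `m/(β + (m−1)λ)`. -/
lemma gq_eq_add_sq (β l η : ℝ) {m : ℕ} (hm : m ≠ 0) (hA : β + ((m : ℝ) - 1) * l ≠ 0) :
    gq β m l η = gq β m l (m / (β + ((m : ℝ) - 1) * l))
      + l * (β + ((m : ℝ) - 1) * l) / m * (η - m / (β + ((m : ℝ) - 1) * l)) ^ 2 := by
  have hm' : (m : ℝ) ≠ 0 := Nat.cast_ne_zero.mpr hm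
  generalize h : β + ((m : ℝ) - 1) * l = A at hA ⊢
  obtain rfl : β = A - ((m : ℝ) - 1) * l := eq_sub_of_add_eq h
  unfold gq
  field_simp
  ring

lemma gq_minimizer_le {β l : ℝ} (η : ℝ) {m : ℕ} (hm : m ≠ 0) (hl : 0 ≤ l)
    (hA : 0 < β + ((m : ℝ) - 1) * l) :
    gq β m l (m / (β + ((m : ℝ) - 1) * l)) ≤ gq β m l η := by
  rw [gq_eq_add_sq β l η hm hA.ne']
  exact le_add_of_nonneg_right (by positivity)

lemma eta0_comm (β a b : ℝ) (m : ℕ) : eta0 β a b m = eta0 β b a m := by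
  rw [eta0, eta0, add_comm a b]

lemma gq_eta0 {β a b : ℝ} {m : ℕ} (hm : m ≠ 0) (hD : β + ((m : ℝ) - 1) * (a + b) ≠ 0) :
    gq β m a (eta0 β a b m)
      = 1 - 4 * (m : ℝ) * ((m : ℝ) - 1) * a * b / (β + ((m : ℝ) - 1) * (a + b)) ^ 2 := by
  have hm' : (m : ℝ) ≠ 0 := Nat.cast_ne_zero.mpr hm
  unfold gq eta0
  field_simp
  ring

/-- With `ηᴵ(m) = min(η₀(m), m/(β + (m−1)λ_k))`, one has
`gᴵ(m, ηᴵ(m)) ≤ gᴵᴵ(m, η₀(m)) = 1 − 4m(m−1)λ₁λ_k/(β + (m−1)(λ₁ + λ_k))²`. -/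
theorem gI_min_le_gII_min
    (β lam1 lamk : ℝ) (hβ : lam1 < β) (h1k : lamk ≤ lam1) (hk : 0 < lamk)
    (m : ℕ) (hm : 1 ≤ m) :
    gq β m lamk (min (eta0 β lam1 lamk m) ((m : ℝ) / (β + ((m : ℝ) - 1) * lamk)))
        ≤ gq β m lam1 (eta0 β lam1 lamk m)
    ∧ gq β m lam1 (eta0 β lam1 lamk m)
        = 1 - 4 * (m : ℝ) * ((m : ℝ) - 1) * lam1 * lamk
            / (β + ((m : ℝ) - 1) * (lam1 + lamk)) ^ 2 := by
  have hm0 : m ≠ 0 := Nat.one_le_iff_ne_zero.mp hm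
  have hm1 : (0 : ℝ) ≤ (m : ℝ) - 1 := sub_nonneg.mpr (mod_cast hm)
  have h1 : 0 < lam1 := hk.trans_le h1k
  have hβ0 : 0 < β := h1.trans hβ
  have hD : 0 < β + ((m : ℝ) - 1) * (lam1 + lamk) := by positivity
  have hval := gq_eta0 hm0 hD.ne'
  refine ⟨?_, hval⟩
  have hsymm : gq β m lamk (eta0 β lam1 lamk m) = gq β m lam1 (eta0 β lam1 lamk m) := by
    rw [hval, eta0_comm, gq_eta0 hm0 (by rw [add_comm lamk]; exact hD.ne'), add_comm lamk,
      mul_right_comm _ lamk]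
  rcases min_choice (eta0 β lam1 lamk m) ((m : ℝ) / (β + ((m : ℝ) - 1) * lamk)) with h | h
  · rw [h, hsymm]
  · rw [h, ← hsymm]
    exact gq_minimizer_le _ hm0 hk.le (by positivity)
end

section
/- In the rate-function setting, for every batch size m ≥ 1: (i) max_{λ ∈ [λ_k, λ₁]} g(λ; m, η*(m)) = g*(m), and (ii) for every η with 0 < η < η₁(m), g*(m) ≤ max_{λ ∈ [λ_k, λ₁]} g(λ; m, η); that is, η*(m) is the optimal step size and g*(m) the optimal convergence rate. -/
/-- `η₁(m) = 2m/(β + (m−1)λ₁)`. -/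
noncomputable def eta1 (β lam1 : ℝ) (m : ℕ) : ℝ :=
  2 * (m : ℝ) / (β + ((m : ℝ) - 1) * lam1)

theorem gq_sub_gq_left {β : ℝ} {m : ℕ} (hm : 1 ≤ m) (a b η : ℝ) :
    gq β m a η - gq β m b η
      = η * (a - b) / m * (η * (β + ((m : ℝ) - 1) * (a + b)) - 2 * m) := by
  have hm0 : (m : ℝ) ≠ 0 := by positivity
  unfold gq
  field_simp
  ring

theorem gq_sub_gq_right {β : ℝ} {m : ℕ} (hm : 1 ≤ m) (l η θ : ℝ) :
    gq β m l η - gq β m l θ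
      = l / m * ((η - θ) * ((β + ((m : ℝ) - 1) * l) * (η + θ) - 2 * m)) := by
  have hm0 : (m : ℝ) ≠ 0 := by positivity
  unfold gq
  field_simp
  ring

/-- The rate function is convex in `l`. -/
theorem convexOn_gq {β : ℝ} {m : ℕ} (hm : 1 ≤ m) (η : ℝ) :
    ConvexOn ℝ Set.univ (fun l => gq β m l η) := by
  have hm1 : (1 : ℝ) ≤ m := by exact_mod_cast hm
  have hm0 : (m : ℝ) ≠ 0 := by positivity
  refine ⟨convex_univ, fun x _ y _ a b ha hb hab => ?_⟩
  obtain rfl : b = 1 - a := by linarith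
  have hgap : a * gq β m x η + (1 - a) * gq β m y η - gq β m (a * x + (1 - a) * y) η
      = a * (1 - a) * (η * (x - y)) ^ 2 * ((m - 1) / m) := by
    unfold gq
    field_simp
    ring
  have hfrac : 0 ≤ ((m : ℝ) - 1) / m := div_nonneg (by linarith) (by linarith)
  have hnonneg : 0 ≤ a * (1 - a) * (η * (x - y)) ^ 2 * (((m : ℝ) - 1) / m) := by positivity
  simp only [smul_eq_mul]
  linarith

/-- The maximum of the rate function over an interval is attained at an endpoint. -/
theorem isGreatest_gq_image_Icc {β a b : ℝ} {m : ℕ} (hm : 1 ≤ m) (hab : a ≤ b) (η : ℝ) :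
    IsGreatest ((fun l => gq β m l η) '' Set.Icc a b) (max (gq β m a η) (gq β m b η)) := by
  constructor
  · rcases max_choice (gq β m a η) (gq β m b η) with h | h <;> rw [h]
    · exact ⟨a, Set.left_mem_Icc.2 hab, rfl⟩
    · exact ⟨b, Set.right_mem_Icc.2 hab, rfl⟩
  · rintro _ ⟨l, hl, rfl⟩
    exact (convexOn_gq hm η).le_max_of_mem_Icc (Set.mem_univ a) (Set.mem_univ b) hl

theorem gq_vertex {β l : ℝ} {m : ℕ} (hm : 1 ≤ m) (hl : 0 < β + ((m : ℝ) - 1) * l) :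
    gq β m l (m / (β + ((m : ℝ) - 1) * l)) = 1 - m * l / (β + ((m : ℝ) - 1) * l) := by
  have hm0 : (m : ℝ) ≠ 0 := by positivity
  unfold gq
  field_simp
  ring

theorem gq_balanced {β a b : ℝ} {m : ℕ} (hm : 1 ≤ m)
    (hD : 0 < β + ((m : ℝ) - 1) * (a + b)) :
    gq β m a (2 * m / (β + ((m : ℝ) - 1) * (a + b)))
      = 1 - 4 * m * ((m : ℝ) - 1) * a * b / (β + ((m : ℝ) - 1) * (a + b)) ^ 2 := by
  have hm0 : (m : ℝ) ≠ 0 := by positivity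
  unfold gq
  field_simp
  ring

/-- In `η`, the rate function is minimal at `m / (β + (m - 1) * l)`. -/
theorem gq_vertex_le {β l : ℝ} {m : ℕ} (hm : 1 ≤ m) (h0 : 0 ≤ l)
    (hl : 0 < β + ((m : ℝ) - 1) * l) (η : ℝ) :
    gq β m l (m / (β + ((m : ℝ) - 1) * l)) ≤ gq β m l η := by
  rw [← sub_nonneg, gq_sub_gq_right hm]
  set θ := (m : ℝ) / (β + ((m : ℝ) - 1) * l) with hθ
  have hmul : (β + ((m : ℝ) - 1) * l) * θ = m := by rw [hθ]; field_simp
  have hsq : (η - θ) * ((β + ((m : ℝ) - 1) * l) * (η + θ) - 2 * m)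
      = (β + ((m : ℝ) - 1) * l) * (η - θ) ^ 2 := by
    linear_combination (2 * (η - θ)) * hmul
  rw [hsq]
  positivity

/-- Optimal step size and optimal convergence rate: in each of the two regimes,
the step size `η*(m)` achieves `max_{λ ∈ [λ_k, λ₁]} g(λ; m, η*(m)) = g*(m)`, and
every step size `0 < η < η₁(m)` has `max_{λ ∈ [λ_k, λ₁]} g(λ; m, η) ≥ g*(m)`. -/
theorem optimal_step_size_and_rate
    (β lam1 lamk : ℝ) (hβ : lam1 < β) (h1k : lamk ≤ lam1) (hk : 0 < lamk)
    (m : ℕ) (hm : 1 ≤ m) :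
    (((m : ℝ) ≤ β / (lam1 - lamk) + 1 ∨ lam1 = lamk) →
      (sSup ((fun l => gq β m l ((m : ℝ) / (β + ((m : ℝ) - 1) * lamk))) ''
            Set.Icc lamk lam1)
          = 1 - (m : ℝ) * lamk / (β + ((m : ℝ) - 1) * lamk)
        ∧ ∀ η : ℝ, 0 < η → η < eta1 β lam1 m →
            1 - (m : ℝ) * lamk / (β + ((m : ℝ) - 1) * lamk)
              ≤ sSup ((fun l => gq β m l η) '' Set.Icc lamk lam1)))
    ∧ ((lamk < lam1 ∧ β / (lam1 - lamk) + 1 < (m : ℝ)) →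
      (sSup ((fun l => gq β m l
              (2 * (m : ℝ) / (β + ((m : ℝ) - 1) * (lam1 + lamk)))) '' Set.Icc lamk lam1)
          = 1 - 4 * (m : ℝ) * ((m : ℝ) - 1) * lam1 * lamk
              / (β + ((m : ℝ) - 1) * (lam1 + lamk)) ^ 2
        ∧ ∀ η : ℝ, 0 < η → η < eta1 β lam1 m →
            1 - 4 * (m : ℝ) * ((m : ℝ) - 1) * lam1 * lamk
                / (β + ((m : ℝ) - 1) * (lam1 + lamk)) ^ 2
              ≤ sSup ((fun l => gq β m l η) '' Set.Icc lamk lam1))) := by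
  have hm1 : (0 : ℝ) ≤ (m : ℝ) - 1 := sub_nonneg.2 (by exact_mod_cast hm)
  have hm0 : (0 : ℝ) < m := by linarith
  have h1 : 0 < lam1 := hk.trans_le h1k
  have hβ0 : 0 < β := h1.trans hβ
  have hEk : 0 < β + ((m : ℝ) - 1) * lamk := by positivity
  have hD : 0 < β + ((m : ℝ) - 1) * (lam1 + lamk) := by positivity
  have hsup (η : ℝ) := (isGreatest_gq_image_Icc (β := β) hm h1k η).csSup_eq
  refine ⟨fun hcase => ?_, fun ⟨hlt, hcase⟩ => ?_⟩
  · have hgap : ((m : ℝ) - 1) * (lam1 - lamk) ≤ β := by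
      rcases h1k.eq_or_lt with h | h
      · rw [h]
        linarith
      · have h' := hcase.resolve_right h.ne'
        rw [← le_div_iff₀ (sub_pos.2 h)]
        linarith
    refine ⟨?_, fun η _ _ => ?_⟩
    · rw [hsup, ← gq_vertex hm hEk, max_eq_left]
      rw [← sub_nonpos, gq_sub_gq_left hm]
      refine mul_nonpos_of_nonneg_of_nonpos ?_ ?_
      · have := sub_nonneg.2 h1k
        positivity
      · rw [sub_nonpos, div_mul_eq_mul_div, div_le_iff₀ hEk]
        nlinarith
    · rw [hsup, ← gq_vertex hm hEk]
      exact le_max_of_le_left (gq_vertex_le hm hk.le hEk η)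
  · have hgap : β < ((m : ℝ) - 1) * (lam1 - lamk) := by
      rw [← div_lt_iff₀ (sub_pos.2 hlt)]
      linarith
    have hval1 := gq_balanced hm hD
    have hvalk : gq β m lamk (2 * m / (β + ((m : ℝ) - 1) * (lam1 + lamk)))
        = 1 - 4 * m * ((m : ℝ) - 1) * lam1 * lamk
          / (β + ((m : ℝ) - 1) * (lam1 + lamk)) ^ 2 := by
      rw [add_comm lam1 lamk, gq_balanced hm (by rwa [add_comm lamk lam1])]
      ring
    refine ⟨by rw [hsup, hval1, hvalk, max_self], fun η _ _ => ?_⟩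
    rw [hsup]
    set θ := 2 * (m : ℝ) / (β + ((m : ℝ) - 1) * (lam1 + lamk)) with hθ
    have hmul : (β + ((m : ℝ) - 1) * (lam1 + lamk)) * θ = 2 * m := by
      rw [hθ]
      field_simp
    have hθ0 : 0 < θ := by positivity
    rcases le_total η θ with h | h
    · refine le_max_of_le_left ?_
      rw [← hvalk, ← sub_nonneg, gq_sub_gq_right hm]
      refine mul_nonneg (by positivity) (mul_nonneg_of_nonpos_of_nonpos (by linarith) ?_)
      have hη := mul_le_mul_of_nonneg_left h hEk.le
      nlinarith
    · refine le_max_of_le_right ?_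
      rw [← hval1, ← sub_nonneg, gq_sub_gq_right hm]
      refine mul_nonneg (by positivity) (mul_nonneg (by linarith) ?_)
      have hE1 : 0 < β + ((m : ℝ) - 1) * lam1 := by positivity
      have hη := mul_le_mul_of_nonneg_left h hE1.le
      have hgap' := mul_nonneg (mul_nonneg hm1 (sub_nonneg.2 h1k)) hθ0.le
      nlinarith
end
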